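/- Fix R > 0, χ₀ > 0, ρ ≥ 2R. On [R,ρ] define χ(r) = χ₀(r−R)², α(r) = 1 + 2(1+i)χ₀(r−R), β(r) = 1 + (1+i)χ(r)/r, and ξ(r) = (r + rχ'(r) + χ(r))/|rα(r)β(r)|². Then the functions r ↦ |α(r)| and r ↦ |β(r)| are nondecreasing on [R,ρ], and consequently 1/r ≤ |α(ρ)|² |β(ρ)|² ξ(r) for all r ∈ [R,ρ]. -/

import Mathlib

noncomputable section

/-- The quadratic PML absorbing profile `χ(r) = χ₀(r−R)²`. -/
def pmlChi (χ₀ R r : ℝ) : ℝ := χ₀ * (r - R) ^ 2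

/-- Its derivative `χ'(r) = 2χ₀(r−R)`. -/
def pmlChi' (χ₀ R r : ℝ) : ℝ := 2 * χ₀ * (r - R)

/-- `α(r) = 1 + 2(1+i)χ₀(r−R)`, the derivative of the complex stretching. -/
def pmlAlpha (χ₀ R r : ℝ) : ℂ := 1 + 2 * (1 + Complex.I) * ((χ₀ * (r - R) : ℝ) : ℂ)

/-- `β(r) = 1 + (1+i)χ(r)/r`. -/
def pmlBeta (χ₀ R r : ℝ) : ℂ := 1 + (1 + Complex.I) * ((pmlChi χ₀ R r : ℝ) : ℂ) / (r : ℂ)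

/-- The real weight `ξ(r) = (r + rχ'(r) + χ(r))/|rα(r)β(r)|²`. -/
def pmlXi (χ₀ R r : ℝ) : ℝ :=
  (r + r * pmlChi' χ₀ R r + pmlChi χ₀ R r) /
    ‖(r : ℂ) * pmlAlpha χ₀ R r * pmlBeta χ₀ R r‖ ^ 2

/-- The real weight `η(r) = (r + rχ'(r) + χ(r) + 2χ(r)χ'(r))/|rβ(r)|²`. -/
def pmlEta (χ₀ R r : ℝ) : ℝ :=
  (r + r * pmlChi' χ₀ R r + pmlChi χ₀ R r + 2 * pmlChi χ₀ R r * pmlChi' χ₀ R r) /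
    ‖(r : ℂ) * pmlBeta χ₀ R r‖ ^ 2

/-- The real weight `ξ₁(r) = (rχ'(r) + χ(r) + 2χ(r)χ'(r))/|rα(r)β(r)|²`. -/
def pmlXi1 (χ₀ R r : ℝ) : ℝ :=
  (r * pmlChi' χ₀ R r + pmlChi χ₀ R r + 2 * pmlChi χ₀ R r * pmlChi' χ₀ R r) /
    ‖(r : ℂ) * pmlAlpha χ₀ R r * pmlBeta χ₀ R r‖ ^ 2

/-- The real weight `η₁(r) = (rχ'(r) − χ(r))/|rβ(r)|²`. -/
def pmlEta1 (χ₀ R r : ℝ) : ℝ :=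
  (r * pmlChi' χ₀ R r - pmlChi χ₀ R r) / ‖(r : ℂ) * pmlBeta χ₀ R r‖ ^ 2

/-- The PML sesquilinear (quadratic) form
`𝒜_λ(v,v) = ∫_R^ρ (rβ)⁻¹ (α⁻¹|v'|² − λα|v|²) dr`. -/
def pmlForm (χ₀ R ρ lam : ℝ) (v v' : ℝ → ℂ) : ℂ :=
  ∫ r in R..ρ, ((r : ℂ) * pmlBeta χ₀ R r)⁻¹ *
    ((pmlAlpha χ₀ R r)⁻¹ * ((‖v' r‖ ^ 2 : ℝ) : ℂ) -
      (lam : ℂ) * pmlAlpha χ₀ R r * ((‖v r‖ ^ 2 : ℝ) : ℂ))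

end

/-- The squared modulus along the ray `t ↦ 1 + (1+i)t`. -/
lemma norm_one_add_one_add_I_mul_sq (t : ℝ) :
    ‖1 + (1 + Complex.I) * (t : ℂ)‖ ^ 2 = (1 + t) ^ 2 + t ^ 2 := by
  rw [Complex.sq_norm, Complex.normSq_apply]
  simp
  ring

/-- The modulus is nondecreasing along the ray `t ↦ 1 + (1+i)t`, `t ≥ 0`. -/
lemma norm_one_add_one_add_I_mul_le {s t : ℝ} (hs : 0 ≤ s) (hst : s ≤ t) :
    ‖1 + (1 + Complex.I) * (s : ℂ)‖ ≤ ‖1 + (1 + Complex.I) * (t : ℂ)‖ := by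
  refine le_of_sq_le_sq ?_ (norm_nonneg _)
  rw [norm_one_add_one_add_I_mul_sq, norm_one_add_one_add_I_mul_sq]
  gcongr

lemma pmlAlpha_eq (χ₀ R r : ℝ) :
    pmlAlpha χ₀ R r = 1 + (1 + Complex.I) * ((2 * (χ₀ * (r - R)) : ℝ) : ℂ) := by
  unfold pmlAlpha
  push_cast
  ring

lemma pmlBeta_eq (χ₀ R r : ℝ) :
    pmlBeta χ₀ R r = 1 + (1 + Complex.I) * ((pmlChi χ₀ R r / r : ℝ) : ℂ) := by
  unfold pmlBeta
  push_cast
  ring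

lemma pmlChi_nonneg {χ₀ : ℝ} (hχ₀ : 0 ≤ χ₀) (R r : ℝ) : 0 ≤ pmlChi χ₀ R r :=
  mul_nonneg hχ₀ (sq_nonneg _)

/-- `χ(r)/r` is nondecreasing for `r ≥ R`. -/
lemma pmlChi_div_le {χ₀ R a b : ℝ} (hR : 0 < R) (hχ₀ : 0 ≤ χ₀) (ha : R ≤ a) (hab : a ≤ b) :
    pmlChi χ₀ R a / a ≤ pmlChi χ₀ R b / b := by
  have ha0 : 0 < a := hR.trans_le ha
  have hb0 : 0 < b := ha0.trans_le hab
  rw [div_le_div_iff₀ ha0 hb0]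
  have hR2 : R ^ 2 ≤ a * b := by nlinarith
  have key : pmlChi χ₀ R b * a - pmlChi χ₀ R a * b = χ₀ * ((b - a) * (a * b - R ^ 2)) := by
    unfold pmlChi
    ring
  have := mul_nonneg hχ₀ (mul_nonneg (sub_nonneg.2 hab) (sub_nonneg.2 hR2))
  linarith

lemma pmlAlpha_norm_monotoneOn {χ₀ : ℝ} (hχ₀ : 0 ≤ χ₀) (R : ℝ) :
    MonotoneOn (fun r : ℝ => ‖pmlAlpha χ₀ R r‖) (Set.Ici R) := by
  intro a ha b _ hab
  have ha' : 0 ≤ a - R := sub_nonneg.2 ha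
  simp only [pmlAlpha_eq]
  apply norm_one_add_one_add_I_mul_le
  · positivity
  · gcongr

lemma pmlBeta_norm_monotoneOn {χ₀ R : ℝ} (hR : 0 < R) (hχ₀ : 0 ≤ χ₀) :
    MonotoneOn (fun r : ℝ => ‖pmlBeta χ₀ R r‖) (Set.Ici R) := by
  intro a ha b _ hab
  simp only [pmlBeta_eq]
  exact norm_one_add_one_add_I_mul_le
    (div_nonneg (pmlChi_nonneg hχ₀ R a) (hR.le.trans ha)) (pmlChi_div_le hR hχ₀ ha hab)

/-- The identity `|α(r)|²|β(r)|² ξ(r) = (r + rχ'(r) + χ(r))/r²` gives the local comparison. -/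
lemma one_div_le_pmlXi {χ₀ R r : ℝ} (hR : 0 < R) (hχ₀ : 0 ≤ χ₀) (hr : R ≤ r) :
    1 / r ≤ ‖pmlAlpha χ₀ R r‖ ^ 2 * ‖pmlBeta χ₀ R r‖ ^ 2 * pmlXi χ₀ R r := by
  have hr0 : 0 < r := hR.trans_le hr
  have hr' : 0 ≤ r - R := sub_nonneg.2 hr
  have hα : ‖pmlAlpha χ₀ R r‖ ^ 2 ≠ 0 := by
    rw [pmlAlpha_eq, norm_one_add_one_add_I_mul_sq]
    positivity
  have hβ : ‖pmlBeta χ₀ R r‖ ^ 2 ≠ 0 := by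
    have := div_nonneg (pmlChi_nonneg hχ₀ R r) hr0.le
    rw [pmlBeta_eq, norm_one_add_one_add_I_mul_sq]
    positivity
  have hχ' : 0 ≤ pmlChi' χ₀ R r := by
    unfold pmlChi'
    positivity
  have key : ‖pmlAlpha χ₀ R r‖ ^ 2 * ‖pmlBeta χ₀ R r‖ ^ 2 * pmlXi χ₀ R r =
      (r + r * pmlChi' χ₀ R r + pmlChi χ₀ R r) / r ^ 2 := by
    unfold pmlXi
    rw [norm_mul, norm_mul, Complex.norm_real, mul_pow, mul_pow, Real.norm_eq_abs, sq_abs]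
    rw [pow_ne_zero_iff two_ne_zero] at hα hβ
    field_simp
  rw [key, div_le_div_iff₀ hr0 (by positivity)]
  have h1 := mul_nonneg (mul_nonneg hr0.le hχ') hr0.le
  have h2 := mul_nonneg (pmlChi_nonneg hχ₀ R r) hr0.le
  nlinarith

lemma pmlXi_nonneg {χ₀ R r : ℝ} (hR : 0 < R) (hχ₀ : 0 ≤ χ₀) (hr : R ≤ r) :
    0 ≤ pmlXi χ₀ R r := by
  have hr0 : 0 < r := hR.trans_le hr
  have hr' : 0 ≤ r - R := sub_nonneg.2 hr
  have hχ := pmlChi_nonneg hχ₀ R r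
  unfold pmlXi pmlChi'
  positivity

/-- The functions `r ↦ |α(r)|` and `r ↦ |β(r)|` are
nondecreasing on `[R,ρ]`, and consequently `1/r ≤ |α(ρ)|²|β(ρ)|² ξ(r)` for all
`r ∈ [R,ρ]`. -/
theorem stmt12 (R χ₀ ρ : ℝ) (hR : 0 < R) (hχ₀ : 0 < χ₀) (hρ : 2 * R ≤ ρ) :
    MonotoneOn (fun r : ℝ => ‖pmlAlpha χ₀ R r‖) (Set.Icc R ρ) ∧
      MonotoneOn (fun r : ℝ => ‖pmlBeta χ₀ R r‖) (Set.Icc R ρ) ∧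
      ∀ r ∈ Set.Icc R ρ,
        1 / r ≤ ‖pmlAlpha χ₀ R ρ‖ ^ 2 * ‖pmlBeta χ₀ R ρ‖ ^ 2 * pmlXi χ₀ R r := by
  refine ⟨(pmlAlpha_norm_monotoneOn hχ₀.le R).mono Set.Icc_subset_Ici_self,
    (pmlBeta_norm_monotoneOn hR hχ₀.le).mono Set.Icc_subset_Ici_self, fun r hr => ?_⟩
  have hρ' : ρ ∈ Set.Ici R := hr.1.trans hr.2
  have hα := pmlAlpha_norm_monotoneOn hχ₀.le R hr.1 hρ' hr.2
  have hβ := pmlBeta_norm_monotoneOn hR hχ₀.le hr.1 hρ' hr.2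
  have hξ := pmlXi_nonneg hR hχ₀.le hr.1
  refine (one_div_le_pmlXi hR hχ₀.le hr.1).trans ?_
  gcongr
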